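/- arXiv:1505.02582 — 5 statements merged into one kernel-verified Lean document; each statement's English description precedes it below -/
import Mathlib

section
/- The function Φ satisfies, for every t ≥ 0, the integral equation Φ(t) = λ·((d−1)!/ρ^(d−1)) · ∫₀ᵗ d·μ·(β − Φ(u)) / (λ − d·μ·(β − Φ(u))) du. In particular Φ is continuously differentiable on [0, ∞) with Φ′(t) = λ·((d−1)!/ρ^(d−1)) · d·μ·(β − Φ(t)) / (λ − d·μ·(β − Φ(t))). -/
open Real Set Filter intervalIntegral

/-- On `[0, β)` the function `y ↦ a * log (1 - y / β) + y` with `β < a` expands distances by at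
least the factor `a / β - 1`. -/
theorem mul_abs_sub_le_abs_log_one_sub_div_add {a β x y : ℝ} (hβ : 0 < β) (ha : β < a)
    (hx : x ∈ Set.Ico 0 β) (hy : y ∈ Set.Ico 0 β) :
    (a / β - 1) * |x - y| ≤
      |(a * Real.log (1 - x / β) + x) - (a * Real.log (1 - y / β) + y)| := by
  wlog hxy : x ≤ y generalizing x y
  · rw [abs_sub_comm x, abs_sub_comm (_ + x)]
    exact this hy hx (le_of_not_ge hxy)
  have ha0 : 0 < a := hβ.trans ha
  have hx1 : 0 < 1 - x / β := by rw [sub_pos, div_lt_one hβ]; exact hx.2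
  have hy1 : 0 < 1 - y / β := by rw [sub_pos, div_lt_one hβ]; exact hy.2
  have hlog := Real.one_sub_inv_le_log_of_pos (div_pos hx1 hy1)
  rw [Real.log_div hx1.ne' hy1.ne', inv_div] at hlog
  have hquot : (y - x) / β ≤ 1 - (1 - y / β) / (1 - x / β) := by
    have heq : 1 - (1 - y / β) / (1 - x / β) = ((y - x) / β) / (1 - x / β) := by
      rw [one_sub_div hx1.ne']
      ring
    rw [heq, le_div_iff₀ hx1]
    exact mul_le_of_le_one_right (div_nonneg (sub_nonneg.2 hxy) hβ.le)
      (sub_le_self _ (div_nonneg hx.1 hβ.le))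
  have hmul := mul_le_mul_of_nonneg_left (hquot.trans hlog) ha0.le
  have hexp : (a / β - 1) * (y - x) = a * ((y - x) / β) - (y - x) := by ring
  rw [abs_of_nonpos (sub_nonpos.2 hxy)]
  refine le_trans ?_ (le_abs_self _)
  linarith

theorem hasDerivAt_log_one_sub_div_add {a β y : ℝ} (hβ : 0 < β) (hy : y < β) :
    HasDerivAt (fun z => a * Real.log (1 - z / β) + z) (1 - a / (β - y)) y := by
  have hy1 : 0 < 1 - y / β := by rw [sub_pos, div_lt_one hβ]; exact hy
  have h := (((((hasDerivAt_id y).div_const β).const_sub 1).log hy1.ne').const_mul a).add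
    (hasDerivAt_id y)
  refine h.congr_deriv ?_
  have : β - y ≠ 0 := (sub_pos.2 hy).ne'
  simp only [id_eq]
  field_simp
  ring

/-- `Φ` satisfies the integral equation
`Φ(t) = λ·((d−1)!/ρ^(d−1))·∫₀ᵗ d·μ·(β − Φ(u))/(λ − d·μ·(β − Φ(u))) du` for all `t ≥ 0`;
in particular it is continuously differentiable on `[0, ∞)` with derivative
`λ·((d−1)!/ρ^(d−1))·d·μ·(β − Φ(t))/(λ − d·μ·(β − Φ(t)))`. -/
theorem stmt3 (d : ℕ) (hd : 1 ≤ d) (μ β lam : ℝ) (hμ : 0 < μ) (hβ : 0 < β)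
    (hlam : 0 < lam) (hstab : (d : ℝ) * μ * β < lam) (ρ : ℝ) (hρ : ρ = lam / μ)
    (Φ : ℝ → ℝ)
    (hΦ : ∀ t : ℝ, 0 ≤ t → Φ t ∈ Set.Ico 0 β ∧
      (1 - Φ t / β) ^ (ρ / (d : ℝ)) * Real.exp (Φ t)
        = Real.exp (-lam * ((Nat.factorial (d - 1) : ℝ) / ρ ^ (d - 1)) * t)) :
    (∀ t : ℝ, 0 ≤ t →
      Φ t = lam * ((Nat.factorial (d - 1) : ℝ) / ρ ^ (d - 1)) *
        ∫ u in (0:ℝ)..t,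
          (d : ℝ) * μ * (β - Φ u) / (lam - (d : ℝ) * μ * (β - Φ u))) ∧
    (∀ t ∈ Set.Ici (0:ℝ),
      HasDerivWithinAt Φ
        (lam * ((Nat.factorial (d - 1) : ℝ) / ρ ^ (d - 1)) *
          ((d : ℝ) * μ * (β - Φ t) / (lam - (d : ℝ) * μ * (β - Φ t))))
        (Set.Ici 0) t) ∧
    ContinuousOn
      (fun t => lam * ((Nat.factorial (d - 1) : ℝ) / ρ ^ (d - 1)) *
        ((d : ℝ) * μ * (β - Φ t) / (lam - (d : ℝ) * μ * (β - Φ t))))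
      (Set.Ici 0) := by
  have hd0 : (0 : ℝ) < d := by exact_mod_cast hd
  have hρ0 : 0 < ρ := hρ ▸ div_pos hlam hμ
  have hlamρ : lam = ρ * μ := by rw [hρ, div_mul_cancel₀ _ hμ.ne']
  set c : ℝ := lam * ((Nat.factorial (d - 1) : ℝ) / ρ ^ (d - 1)) with hc
  have hc0 : 0 < c := by positivity
  have ha : β < ρ / d := by
    rw [lt_div_iff₀ hd0]
    refine lt_of_mul_lt_mul_right ?_ hμ.le
    linarith
  have hmem : ∀ t, 0 ≤ t → Φ t ∈ Set.Ico 0 β := fun t ht => (hΦ t ht).1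
  have hden : ∀ t, 0 ≤ t → 0 < lam - (d : ℝ) * μ * (β - Φ t) := fun t ht => by
    have := mul_nonneg (mul_nonneg hd0.le hμ.le) (hmem t ht).1
    linarith
  have hlog : ∀ t, 0 ≤ t → ρ / d * Real.log (1 - Φ t / β) + Φ t = -c * t := fun t ht => by
    have hpos : 0 < 1 - Φ t / β := by rw [sub_pos, div_lt_one hβ]; exact (hmem t ht).2
    have h := congrArg Real.log (hΦ t ht).2
    rw [Real.log_mul (Real.rpow_pos_of_pos hpos _).ne' (Real.exp_pos _).ne',
      Real.log_rpow hpos, Real.log_exp, Real.log_exp] at h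
    rw [h, hc]
    ring
  have hm : 0 < ρ / d / β - 1 := by rw [sub_pos, one_lt_div hβ]; exact ha
  have hcont : ContinuousOn Φ (Set.Ici 0) := by
    refine (LipschitzOnWith.of_dist_le' (K := c / (ρ / d / β - 1)) fun s hs t ht => ?_).continuousOn
    have h := mul_abs_sub_le_abs_log_one_sub_div_add hβ ha (hmem s hs) (hmem t ht)
    rw [hlog s hs, hlog t ht, ← mul_sub, abs_mul, abs_neg, abs_of_pos hc0] at h
    rw [Real.dist_eq, Real.dist_eq, div_mul_eq_mul_div, le_div_iff₀ hm, mul_comm]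
    exact h
  have hcontF : ContinuousOn
      (fun t => (d : ℝ) * μ * (β - Φ t) / (lam - (d : ℝ) * μ * (β - Φ t))) (Set.Ici 0) :=
    (continuousOn_const.mul (continuousOn_const.sub hcont)).div
      (continuousOn_const.sub (continuousOn_const.mul (continuousOn_const.sub hcont)))
      fun t ht => (hden t ht).ne'
  have hderiv : ∀ t ∈ Set.Ici (0 : ℝ), HasDerivWithinAt Φ
      (c * ((d : ℝ) * μ * (β - Φ t) / (lam - (d : ℝ) * μ * (β - Φ t)))) (Set.Ici 0) t := by
    intro t ht
    have hβΦ : 0 < β - Φ t := sub_pos.2 (hmem t ht).2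
    have hdt := hden t ht
    have hG := hasDerivAt_log_one_sub_div_add (a := ρ / d) hβ (hmem t ht).2
    have hslope : 1 - ρ / d / (β - Φ t) = -(lam - d * μ * (β - Φ t)) / (d * μ * (β - Φ t)) := by
      rw [hlamρ]
      field_simp
      ring
    rw [hslope] at hG
    have hf := (hG.div_const (-c)).hasFDerivAt_equiv
      (div_ne_zero (div_ne_zero (neg_ne_zero.2 hdt.ne') (by positivity)) (neg_ne_zero.2 hc0.ne'))
    have h := HasFDerivWithinAt.of_local_left_inverse (t := Set.univ) (s := Set.Ici 0)
      (by rw [nhdsWithin_univ]; exact hcont t ht) hf.hasFDerivWithinAt ht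
      (eventually_mem_nhdsWithin.mono fun s hs => by
        rw [hlog s hs, mul_div_cancel_left₀ _ (neg_ne_zero.2 hc0.ne')])
    refine h.hasDerivWithinAt.congr_deriv ?_
    simp only [ContinuousLinearEquiv.coe_coe, ContinuousLinearEquiv.unitsEquivAut_apply_symm,
      Units.val_inv_eq_inv_val, Units.val_mk0, one_mul]
    field_simp
  refine ⟨fun t ht => ?_, hderiv, continuousOn_const.mul hcontF⟩
  have hΦ0 : Φ 0 = 0 := by
    have h := mul_abs_sub_le_abs_log_one_sub_div_add hβ ha (hmem 0 le_rfl) ⟨le_rfl, hβ⟩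
    rw [hlog 0 le_rfl] at h
    simp only [mul_zero, sub_zero, zero_div, Real.log_one, add_zero, abs_zero] at h
    exact abs_nonpos_iff.1 (nonpos_of_mul_nonpos_right h hm)
  have hsub : Set.Icc 0 t ⊆ Set.Ici (0 : ℝ) := Set.Icc_subset_Ici_self
  rw [← intervalIntegral.integral_const_mul,
    intervalIntegral.integral_eq_sub_of_hasDerivAt_of_le ht (hcont.mono hsub)
      (fun x hx => (hderiv x hx.1.le).hasDerivAt (Ici_mem_nhds hx.1))
      (ContinuousOn.intervalIntegrable_of_Icc ht ((continuousOn_const.mul hcontF).mono hsub)),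
    hΦ0, sub_zero]
end

section
/- If Ψ : [0, ∞) → [0, β) is any continuous function satisfying, for every t ≥ 0, the integral equation Ψ(t) = λ·((d−1)!/ρ^(d−1)) · ∫₀ᵗ d·μ·(β − Ψ(u)) / (λ − d·μ·(β − Ψ(u))) du, then Ψ(t) = Φ(t) for all t ≥ 0; that is, every continuous solution of this integral equation with values in [0, β) satisfies the implicit equation (1 − Ψ(t)/β)^(ρ/d) · exp(Ψ(t)) = exp(−λ·((d−1)!/ρ^(d−1))·t). -/
open Real Set Filter intervalIntegral

/-- The logarithm of `(1 - y / β) ^ r * exp y` is strictly decreasing on `[0, β)` when `β < r`. -/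
lemma strictAntiOn_mul_log_one_sub_div_add {β r : ℝ} (hβ : 0 < β) (hr : β < r) :
    StrictAntiOn (fun y => r * Real.log (1 - y / β) + y) (Set.Ico 0 β) := by
  intro a ha b hb hab
  have hpos : ∀ y ∈ Set.Ico (0 : ℝ) β, 0 < 1 - y / β := fun y hy => by
    have := (div_lt_one hβ).2 hy.2
    linarith
  have hlog : Real.log (1 - b / β) - Real.log (1 - a / β) ≤ (a - b) / (β - a) := by
    rw [← Real.log_div (hpos b hb).ne' (hpos a ha).ne']
    refine (Real.log_le_sub_one_of_pos (div_pos (hpos b hb) (hpos a ha))).trans_eq ?_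
    have h1 : β - a ≠ 0 := (sub_pos.2 ha.2).ne'
    have h2 : 1 - a / β ≠ 0 := (hpos a ha).ne'
    rw [div_sub_one h2, div_eq_div_iff h2 h1]
    field_simp
    ring
  have hmul : r * ((a - b) / (β - a)) < a - b := by
    rw [← mul_div_assoc, div_lt_iff₀ (sub_pos.2 ha.2)]
    nlinarith [ha.1]
  have := mul_le_mul_of_nonneg_left hlog (hβ.trans hr).le
  simp only
  linarith

lemma rpow_mul_exp_eq_exp {x : ℝ} (hx : 0 < x) (r y : ℝ) :
    x ^ r * Real.exp y = Real.exp (r * Real.log x + y) := by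
  rw [Real.rpow_def_of_pos hx, ← Real.exp_add, mul_comm]

/-- A continuous solution of an autonomous integral equation on `[0, ∞)` agrees there with a
function that is differentiable at every nonnegative time. -/
lemma exists_hasDerivAt_of_integral_eq {f Ψ : ℝ → ℝ} {s : Set ℝ} {c : ℝ}
    (hf : ContinuousOn f s) (hΨ : ContinuousOn Ψ (Set.Ici 0)) (hs : ∀ t, 0 ≤ t → Ψ t ∈ s)
    (h : ∀ t, 0 ≤ t → Ψ t = c * ∫ u in (0 : ℝ)..t, f (Ψ u)) :
    ∃ Y : ℝ → ℝ, (∀ t, 0 ≤ t → Y t = Ψ t) ∧ ∀ t, 0 ≤ t → HasDerivAt Y (c * f (Ψ t)) t := by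
  have hmax : ∀ u : ℝ, max u 0 ∈ Set.Ici (0 : ℝ) := fun u => le_max_right u 0
  have hcont : Continuous fun u : ℝ => f (Ψ (max u 0)) :=
    hf.comp_continuous (hΨ.comp_continuous (by fun_prop) hmax) fun u => hs _ (hmax u)
  refine ⟨fun t => c * ∫ u in (0 : ℝ)..t, f (Ψ (max u 0)), fun t ht => ?_, fun t ht => ?_⟩
  · rw [h t ht]
    refine congrArg (c * ·) ?_
    apply intervalIntegral.integral_congr
    intro u hu
    rw [Set.uIcc_of_le ht] at hu
    simp only [max_eq_left hu.1]
  · have := (hcont.integral_hasStrictDerivAt 0 t).hasDerivAt.const_mul c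
    rwa [max_eq_left ht] at this

/-- Any continuous `Ψ : [0, ∞) → [0, β)` satisfying the integral equation
`Ψ(t) = λ·((d−1)!/ρ^(d−1))·∫₀ᵗ d·μ·(β − Ψ(u))/(λ − d·μ·(β − Ψ(u))) du` coincides with `Φ`;
equivalently, it satisfies the implicit equation
`(1 − Ψ(t)/β)^(ρ/d)·exp(Ψ(t)) = exp(−λ·((d−1)!/ρ^(d−1))·t)`. -/
theorem stmt4 (d : ℕ) (hd : 1 ≤ d) (μ β lam : ℝ) (hμ : 0 < μ) (hβ : 0 < β)
    (hlam : 0 < lam) (hstab : (d : ℝ) * μ * β < lam) (ρ : ℝ) (hρ : ρ = lam / μ)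
    (Φ : ℝ → ℝ)
    (hΦ : ∀ t : ℝ, 0 ≤ t → Φ t ∈ Set.Ico 0 β ∧
      (1 - Φ t / β) ^ (ρ / (d : ℝ)) * Real.exp (Φ t)
        = Real.exp (-lam * ((Nat.factorial (d - 1) : ℝ) / ρ ^ (d - 1)) * t))
    (Ψ : ℝ → ℝ)
    (hΨcont : ContinuousOn Ψ (Set.Ici 0))
    (hΨmem : ∀ t : ℝ, 0 ≤ t → Ψ t ∈ Set.Ico 0 β)
    (hΨeq : ∀ t : ℝ, 0 ≤ t →
      Ψ t = lam * ((Nat.factorial (d - 1) : ℝ) / ρ ^ (d - 1)) *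
        ∫ u in (0:ℝ)..t,
          (d : ℝ) * μ * (β - Ψ u) / (lam - (d : ℝ) * μ * (β - Ψ u))) :
    (∀ t : ℝ, 0 ≤ t → Ψ t = Φ t) ∧
    (∀ t : ℝ, 0 ≤ t →
      (1 - Ψ t / β) ^ (ρ / (d : ℝ)) * Real.exp (Ψ t)
        = Real.exp (-lam * ((Nat.factorial (d - 1) : ℝ) / ρ ^ (d - 1)) * t)) := by
  have hd0 : (0 : ℝ) < d := by exact_mod_cast hd
  set C : ℝ := lam * ((Nat.factorial (d - 1) : ℝ) / ρ ^ (d - 1)) with hC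
  have hr : β < ρ / d := by
    rw [lt_div_iff₀ hd0, hρ, lt_div_iff₀ hμ]
    linarith
  have hpos : ∀ y ∈ Set.Ico (0 : ℝ) β, 0 < 1 - y / β := fun y hy => by
    have := (div_lt_one hβ).2 hy.2
    linarith
  have hden : ∀ y ∈ Set.Ico (0 : ℝ) β, 0 < lam - d * μ * (β - y) := fun y hy => by
    have := mul_nonneg (mul_pos hd0 hμ).le hy.1
    linarith
  have hf : ContinuousOn (fun y => (d : ℝ) * μ * (β - y) / (lam - (d : ℝ) * μ * (β - y)))
      (Set.Ico 0 β) :=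
    ContinuousOn.div (by fun_prop) (by fun_prop) fun y hy => (hden y hy).ne'
  obtain ⟨Y, hY, hY'⟩ := exists_hasDerivAt_of_integral_eq hf hΨcont hΨmem hΨeq
  have hderiv : ∀ t, 0 ≤ t →
      HasDerivAt (fun t => ρ / d * Real.log (1 - Y t / β) + Y t + C * t) 0 t := fun t ht => by
    have hmem := hΨmem t ht
    have h1 := ((hY' t ht).div_const β).const_sub 1
    have h2 := h1.log (by rw [hY t ht]; exact (hpos _ hmem).ne')
    have h3 := ((h2.const_mul (ρ / d)).add (hY' t ht)).add ((hasDerivAt_id t).const_mul C)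
    refine h3.congr_deriv ?_
    have hβΨ : β - Ψ t ≠ 0 := (sub_pos.2 hmem.2).ne'
    have hdenΨ := (hden _ hmem).ne'
    have hsub : 1 - Ψ t / β = (β - Ψ t) / β := by field_simp
    rw [hY t ht, hsub, hρ]
    set D := lam - d * μ * (β - Ψ t) with hD
    rw [show lam = D + d * μ * (β - Ψ t) by rw [hD]; ring]
    field_simp
    ring
  have hΨ0 : Ψ 0 = 0 := by simpa using hΨeq 0 le_rfl
  have hlog : ∀ t, 0 ≤ t → ρ / d * Real.log (1 - Ψ t / β) + Ψ t = -(C * t) := fun t ht => by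
    have := constant_of_has_deriv_right_zero
      (fun x hx => (hderiv x hx.1).continuousAt.continuousWithinAt)
      (fun x hx => (hderiv x hx.1).hasDerivWithinAt) t (Set.right_mem_Icc.2 ht)
    simp only [hY t ht, hY 0 le_rfl, hΨ0] at this
    norm_num at this
    linarith
  have himp : ∀ t, 0 ≤ t → (1 - Ψ t / β) ^ (ρ / (d : ℝ)) * Real.exp (Ψ t)
      = Real.exp (-lam * ((Nat.factorial (d - 1) : ℝ) / ρ ^ (d - 1)) * t) := fun t ht => by
    rw [rpow_mul_exp_eq_exp (hpos _ (hΨmem t ht)), hlog t ht, hC]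
    ring_nf
  refine ⟨fun t ht => ?_, himp⟩
  obtain ⟨hΦmem, hΦt⟩ := hΦ t ht
  refine (strictAntiOn_mul_log_one_sub_div_add hβ hr).injOn (hΨmem t ht) hΦmem ?_
  apply Real.exp_injective
  rw [← rpow_mul_exp_eq_exp (hpos _ (hΨmem t ht)), ← rpow_mul_exp_eq_exp (hpos _ hΦmem),
    himp t ht, hΦt]
end

section
/- Define s_k(t) = 0 for 1 ≤ k ≤ d−1, s_d(t) = β, r₀(t) = t, r_k(t) = t for 1 ≤ k ≤ d−2, and r_{d−1}(t) = (1 − d·μ·β/λ)·t. Then for every 1 ≤ k ≤ d−1 and every t ≥ 0 the fluid equation s_k(t) = μ·(k+1)·∫₀ᵗ (s_{k+1}(u) − s_k(u)) du − μ·∫₀ᵗ s₁(u) du − λ·(r_{k−1}(t) − r_k(t)) holds, and each r_k (1 ≤ k ≤ d−1) is nondecreasing with r_k(0) = 0. (This verifies that in the stable case the constant trajectory (x₁,…,x_d) = (0,…,0,β) solves the reflected fluid system.) -/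
open Real Set Filter intervalIntegral

/-- In the stable case `λ > d·μ·β`, the constant trajectory
`s_k ≡ 0` for `1 ≤ k ≤ d−1`, `s_d ≡ β`, with reflection terms `r₀(t) = t`,
`r_k(t) = t` for `1 ≤ k ≤ d−2` and `r_{d−1}(t) = (1 − d·μ·β/λ)·t`, solves the reflected
fluid system: for every `1 ≤ k ≤ d−1` and `t ≥ 0`,
`s_k(t) = μ·(k+1)·∫₀ᵗ (s_{k+1}(u) − s_k(u)) du − μ·∫₀ᵗ s₁(u) du − λ·(r_{k−1}(t) − r_k(t))`,
and each `r_k` (`1 ≤ k ≤ d−1`) is nondecreasing with `r_k(0) = 0`. -/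
theorem stmt12 (d : ℕ) (hd : 2 ≤ d) (μ β lam : ℝ) (hμ : 0 < μ) (hβ : 0 < β)
    (hlam : 0 < lam) (hstab : (d : ℝ) * μ * β < lam)
    (s r : ℕ → ℝ → ℝ)
    (hs : ∀ k : ℕ, 1 ≤ k → k ≤ d - 1 → ∀ t : ℝ, s k t = 0)
    (hsd : ∀ t : ℝ, s d t = β)
    (hr0 : ∀ t : ℝ, r 0 t = t)
    (hrk : ∀ k : ℕ, 1 ≤ k → k ≤ d - 2 → ∀ t : ℝ, r k t = t)
    (hrd : ∀ t : ℝ, r (d - 1) t = (1 - (d : ℝ) * μ * β / lam) * t) :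
    (∀ k : ℕ, 1 ≤ k → k ≤ d - 1 → ∀ t : ℝ, 0 ≤ t →
      s k t = μ * ((k : ℝ) + 1) * (∫ u in (0:ℝ)..t, (s (k + 1) u - s k u)) -
        μ * (∫ u in (0:ℝ)..t, s 1 u) - lam * (r (k - 1) t - r k t)) ∧
    (∀ k : ℕ, 1 ≤ k → k ≤ d - 1 →
      MonotoneOn (r k) (Set.Ici 0) ∧ r k 0 = 0) := by
  have hr : ∀ k, k ≤ d - 2 → ∀ t, r k t = t := by
    intro k hk t
    rcases Nat.eq_zero_or_pos k with rfl | h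
    · exact hr0 t
    · exact hrk k h hk t
  have hs1 : ∀ t, s 1 t = 0 := hs 1 le_rfl (by omega)
  refine ⟨fun k hk1 hk t _ => ?_, fun k hk1 hk => ?_⟩
  · rcases Nat.lt_or_ge k (d - 1) with h | h
    · simp [hs k hk1 hk, hs (k + 1) (by omega) (by omega), hs1,
        hr k (by omega), hr (k - 1) (by omega)]
    · obtain rfl : k = d - 1 := le_antisymm hk h
      have hsucc : d - 1 + 1 = d := by omega
      have hcast : ((d - 1 : ℕ) : ℝ) + 1 = d := by exact_mod_cast hsucc
      rw [hsucc, hcast, hr (d - 1 - 1) (by omega), hrd]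
      simp only [hs _ hk1 hk, hs1, hsd, integral_const, smul_eq_mul]
      field_simp
      ring
  · rcases Nat.lt_or_ge k (d - 1) with h | h
    · refine ⟨fun x _ y _ hxy => ?_, hr k (by omega) 0⟩
      rwa [hr k (by omega), hr k (by omega)]
    · obtain rfl : k = d - 1 := le_antisymm hk h
      refine ⟨fun x _ y _ hxy => ?_, by rw [hrd, mul_zero]⟩
      rw [hrd, hrd]
      exact mul_le_mul_of_nonneg_left hxy
        (sub_nonneg.mpr ((div_le_one hlam).mpr hstab.le))
end

section
/- Set C = (27/256)·(4β − ρ)⁴/(3β − ρ)³, s₃(t) = β − C·exp(−4·μ·t) and s₂(t) = (3β − ρ) − (4β − ρ)·exp(−μ·t) + C·exp(−4·μ·t). Then for all t ∈ ℝ, s₂′(t) = 3·μ·s₃(t) − μ·s₂(t) − μ·ρ, and moreover s₂(t₃) = 0 where t₃ = (1/μ)·log( (3/4)·(4β − ρ)/(3β − ρ) ). -/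
open Real Set Filter

/-- With `C = (27/256)·(4β − ρ)⁴/(3β − ρ)³`,
`s₃(t) = β − C·exp(−4μt)` and `s₂(t) = (3β − ρ) − (4β − ρ)·exp(−μt) + C·exp(−4μt)`,
one has `s₂′(t) = 3·μ·s₃(t) − μ·s₂(t) − μ·ρ` for all `t`, and `s₂(t₃) = 0` where
`t₃ = (1/μ)·log((3/4)·(4β − ρ)/(3β − ρ))`. -/
theorem stmt14 (μ β lam ρ : ℝ) (hμ : 0 < μ) (hβ : 0 < β) (hlam : 0 < lam)
    (hρ : ρ = lam / μ) (h2 : 2 * β < ρ) (h3 : ρ < 3 * β)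
    (C : ℝ) (hC : C = (27 / 256) * (4 * β - ρ) ^ 4 / (3 * β - ρ) ^ 3)
    (s3 s2 : ℝ → ℝ)
    (hs3 : ∀ t : ℝ, s3 t = β - C * Real.exp (-4 * μ * t))
    (hs2 : ∀ t : ℝ, s2 t = (3 * β - ρ) - (4 * β - ρ) * Real.exp (-μ * t) +
        C * Real.exp (-4 * μ * t))
    (t3 : ℝ) (ht3 : t3 = (1 / μ) * Real.log ((3 / 4) * (4 * β - ρ) / (3 * β - ρ))) :
    (∀ t : ℝ, HasDerivAt s2 (3 * μ * s3 t - μ * s2 t - μ * ρ) t) ∧ s2 t3 = 0 := by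
  constructor
  · intro t
    have hexp (c : ℝ) : HasDerivAt (fun x : ℝ => Real.exp (c * x)) (Real.exp (c * t) * c) t := by
      simpa using ((hasDerivAt_id t).const_mul c).exp
    have hderiv := (((hexp (-μ)).const_mul (4 * β - ρ)).const_sub (3 * β - ρ)).add
      ((hexp (-4 * μ)).const_mul C)
    rw [funext hs2]
    refine hderiv.congr_deriv ?_
    rw [hs3]
    ring
  · have ha : 0 < 3 * β - ρ := by linarith
    have hb : 0 < 4 * β - ρ := by linarith
    have hexp : Real.exp (-μ * t3) = ((3 / 4) * (4 * β - ρ) / (3 * β - ρ))⁻¹ := by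
      have hlog : -μ * t3 = -Real.log ((3 / 4) * (4 * β - ρ) / (3 * β - ρ)) := by
        rw [ht3]
        field_simp
      rw [hlog, Real.exp_neg, Real.exp_log (by positivity)]
    have hexp4 : Real.exp (-4 * μ * t3) = Real.exp (-μ * t3) ^ 4 := by
      rw [← Real.exp_nat_mul]
      congr 1
      push_cast
      ring
    rw [hs2, hexp4, hexp, hC]
    generalize 3 * β - ρ = a at ha ⊢
    generalize 4 * β - ρ = b at hb ⊢
    field_simp
    ring
end

section
/- The function G : [0, β̃) → ℝ defined by G(y) = (1 − y/β̃)^(ρ/(p·(p+1))) · exp(y) is a continuous strictly decreasing bijection from [0, β̃) onto (0, 1]; consequently, for every t ≥ 0 there is a unique Φ₀(t) ∈ [0, β̃) with G(Φ₀(t)) = exp(−λ·((p−1)!/ρ^(p−1))·t), and the resulting function Φ₀ satisfies Φ₀(0) = 0, is continuous and strictly increasing, and Φ₀(t) → β̃ = β − ρ/(p+1) as t → ∞. -/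
open Real Set Filter

/-- The function `y ↦ (1 - y / b) ^ a * exp y` is strictly decreasing on `[0, b]` when `b < a`. -/
theorem strictAntiOn_one_sub_div_rpow_mul_exp {a b : ℝ} (hb : 0 < b) (hab : b < a) :
    StrictAntiOn (fun y : ℝ => (1 - y / b) ^ a * Real.exp y) (Set.Icc 0 b) := by
  intro x hx y hy hxy
  have hxb : x < b := hxy.trans_le hy.2
  have hpos : ∀ z < b, 0 < 1 - z / b := fun z hz => by
    rw [sub_pos, div_lt_one hb]; exact hz
  have hx1 := hpos x hxb
  change (1 - y / b) ^ a * Real.exp y < (1 - x / b) ^ a * Real.exp x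
  rcases hy.2.eq_or_lt with rfl | hyb
  · rw [div_self hb.ne', sub_self, Real.zero_rpow (hb.trans hab).ne', zero_mul]
    positivity
  have hy1 := hpos y hyb
  rw [Real.rpow_def_of_pos hx1, Real.rpow_def_of_pos hy1, ← Real.exp_add, ← Real.exp_add,
    Real.exp_lt_exp]
  have hlog := Real.log_le_sub_one_of_pos (div_pos hy1 hx1)
  rw [Real.log_div hy1.ne' hx1.ne'] at hlog
  have hbx : 0 < b - x := sub_pos.2 hxb
  have hratio : (1 - y / b) / (1 - x / b) - 1 = -((y - x) / (b - x)) := by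
    have : (1 - x / b) = (b - x) / b := by field_simp
    rw [this]
    field_simp
    ring
  rw [hratio] at hlog
  have hgap : y - x < a * ((y - x) / (b - x)) := by
    rw [← mul_div_assoc, lt_div_iff₀ hbx]
    nlinarith [hx.1]
  nlinarith [mul_le_mul_of_nonneg_left hlog (hb.trans hab).le]

/-- The function `y ↦ (1 - y / b) ^ a * exp y` is continuous for a nonnegative exponent `a`. -/
theorem continuous_one_sub_div_rpow_mul_exp {a : ℝ} (ha : 0 ≤ a) (b : ℝ) :
    Continuous (fun y : ℝ => (1 - y / b) ^ a * Real.exp y) :=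
  ((continuous_const.sub (continuous_id.div_const b)).rpow_const fun _ => Or.inr ha).mul
    Real.continuous_exp

/-- A continuous strictly decreasing function on `[0, b]` from `1` to `0` restricts to a bijection
from `[0, b)` onto `(0, 1]`. -/
theorem bijOn_Ico_Ioc_of_strictAntiOn {G : ℝ → ℝ} {b : ℝ} (hb : 0 < b)
    (hc : ContinuousOn G (Set.Icc 0 b)) (ha : StrictAntiOn G (Set.Icc 0 b))
    (h0 : G 0 = 1) (h1 : G b = 0) : Set.BijOn G (Set.Ico 0 b) (Set.Ioc 0 1) := by
  have hl : (0 : ℝ) ∈ Set.Icc 0 b := Set.left_mem_Icc.2 hb.le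
  have hr : b ∈ Set.Icc 0 b := Set.right_mem_Icc.2 hb.le
  refine ⟨fun y hy => ⟨?_, ?_⟩, (ha.mono Set.Ico_subset_Icc_self).injOn, fun z hz => ?_⟩
  · exact h1 ▸ ha (Set.Ico_subset_Icc_self hy) hr hy.2
  · exact h0 ▸ ha.antitoneOn hl (Set.Ico_subset_Icc_self hy) hy.1
  · obtain ⟨y, hy, rfl⟩ := intermediate_value_Icc' hb.le hc
      (show z ∈ Set.Icc (G b) (G 0) by rw [h0, h1]; exact Set.Ioc_subset_Icc_self hz)
    refine ⟨y, ⟨hy.1, hy.2.lt_of_ne ?_⟩, rfl⟩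
    rintro rfl
    exact hz.1.ne' h1

/-- A strictly monotone function on `s` whose image is `t` is continuous on `s` when `s` and `t` are
order-connected. -/
theorem StrictMonoOn.continuousOn_of_bijOn {f : ℝ → ℝ} {s t : Set ℝ} [s.OrdConnected]
    [t.OrdConnected] (hf : StrictMonoOn f s) (h : Set.BijOn f s t) : ContinuousOn f s := by
  obtain rfl := h.image_eq
  rw [continuousOn_iff_continuous_domRestrict]
  exact continuous_subtype_val.comp (hf.orderIso f s).continuous

/-- Solutions `Φ t` of `G (Φ t) = exp (-k t)`, for `G` a strictly decreasing bijection from `[0, b)`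
onto `(0, 1]`, form an increasing homeomorphism from `[0, ∞)` onto `[0, b)`. -/
theorem solution_of_eq_exp_neg {G Φ : ℝ → ℝ} {b k : ℝ} (hb : 0 < b) (hk : 0 < k)
    (ha : StrictAntiOn G (Set.Ico 0 b)) (hG : Set.BijOn G (Set.Ico 0 b) (Set.Ioc 0 1))
    (h0 : G 0 = 1)
    (hΦ : ∀ t : ℝ, 0 ≤ t → Φ t ∈ Set.Ico 0 b ∧ G (Φ t) = Real.exp (-(k * t))) :
    Φ 0 = 0 ∧ ContinuousOn Φ (Set.Ici 0) ∧ StrictMonoOn Φ (Set.Ici 0) ∧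
      Tendsto Φ atTop (nhds b) := by
  have hmono : StrictMonoOn Φ (Set.Ici 0) := by
    intro s hs t ht hst
    rw [← ha.lt_iff_gt (hΦ t ht).1 (hΦ s hs).1, (hΦ s hs).2, (hΦ t ht).2, Real.exp_lt_exp]
    exact neg_lt_neg (mul_lt_mul_of_pos_left hst hk)
  have hsurj : Set.SurjOn Φ (Set.Ici 0) (Set.Ico 0 b) := by
    intro y hy
    obtain ⟨hpos, hle⟩ := hG.mapsTo hy
    have ht : 0 ≤ -Real.log (G y) / k :=
      div_nonneg (neg_nonneg.2 (Real.log_nonpos hpos.le hle)) hk.le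
    refine ⟨_, ht, hG.injOn (hΦ _ ht).1 hy ?_⟩
    rw [(hΦ _ ht).2, mul_div_cancel₀ _ hk.ne', neg_neg, Real.exp_log hpos]
  have hbij : Set.BijOn Φ (Set.Ici 0) (Set.Ico 0 b) :=
    ⟨fun t ht => (hΦ t ht).1, hmono.injOn, hsurj⟩
  refine ⟨hG.injOn (hΦ 0 le_rfl).1 ⟨le_rfl, hb⟩ ?_, hmono.continuousOn_of_bijOn hbij, hmono, ?_⟩
  · rw [(hΦ 0 le_rfl).2, h0, mul_zero, neg_zero, Real.exp_zero]
  · refine tendsto_order.2 ⟨fun c hc => ?_, fun c hc => ?_⟩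
    · obtain ⟨s, hs, hsc⟩ := hsurj (show max c 0 ∈ Set.Ico 0 b from
        ⟨le_max_right _ _, max_lt hc hb⟩)
      filter_upwards [eventually_gt_atTop s] with t ht
      calc c ≤ Φ s := hsc ▸ le_max_left _ _
        _ < Φ t := hmono hs (le_trans hs ht.le) ht
    · filter_upwards [eventually_ge_atTop 0] with t ht
      exact (hΦ t ht).1.2.trans hc

/-- In the overloaded case `p·μ·β < λ < (p+1)·μ·β` with `β̃ = β − ρ/(p+1)`,
the function `G(y) = (1 − y/β̃)^(ρ/(p(p+1)))·exp(y)` is a continuous strictly decreasing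
bijection from `[0, β̃)` onto `(0, 1]`; consequently, for every `t ≥ 0` there is a unique
`Φ₀(t) ∈ [0, β̃)` with `G(Φ₀(t)) = exp(−λ·((p−1)!/ρ^(p−1))·t)`, and the resulting `Φ₀`
satisfies `Φ₀(0) = 0`, is continuous and strictly increasing, and tends to `β̃` at `∞`. -/
theorem stmt15 (p : ℕ) (hp : 2 ≤ p) (μ β lam : ℝ) (hμ : 0 < μ) (hβ : 0 < β)
    (h1 : (p : ℝ) * μ * β < lam) (h2 : lam < ((p : ℝ) + 1) * μ * β)
    (ρ βt : ℝ) (hρ : ρ = lam / μ) (hβt : βt = β - ρ / ((p : ℝ) + 1))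
    (G : ℝ → ℝ)
    (hG : ∀ y : ℝ, G y = (1 - y / βt) ^ (ρ / ((p : ℝ) * ((p : ℝ) + 1))) * Real.exp y) :
    (ContinuousOn G (Set.Ico 0 βt) ∧ StrictAntiOn G (Set.Ico 0 βt) ∧
      Set.BijOn G (Set.Ico 0 βt) (Set.Ioc 0 1)) ∧
    (∀ t : ℝ, 0 ≤ t → ∃! y : ℝ, y ∈ Set.Ico 0 βt ∧
      G y = Real.exp (-lam * ((Nat.factorial (p - 1) : ℝ) / ρ ^ (p - 1)) * t)) ∧
    (∀ Φ0 : ℝ → ℝ,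
      (∀ t : ℝ, 0 ≤ t → Φ0 t ∈ Set.Ico 0 βt ∧
        G (Φ0 t) = Real.exp (-lam * ((Nat.factorial (p - 1) : ℝ) / ρ ^ (p - 1)) * t)) →
      Φ0 0 = 0 ∧ ContinuousOn Φ0 (Set.Ici 0) ∧ StrictMonoOn Φ0 (Set.Ici 0) ∧
        Tendsto Φ0 atTop (nhds βt)) := by
  obtain rfl : G = fun y : ℝ =>
      (1 - y / βt) ^ (ρ / ((p : ℝ) * ((p : ℝ) + 1))) * Real.exp y := funext hG
  have hp0 : (0 : ℝ) < p := by exact_mod_cast (by omega : 0 < p)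
  have hlam : 0 < lam := lt_trans (by positivity) h1
  have hρ0 : 0 < ρ := hρ ▸ div_pos hlam hμ
  have hlow : (p : ℝ) * β < ρ := by
    rw [hρ, lt_div_iff₀ hμ]; linarith
  have hupp : ρ < ((p : ℝ) + 1) * β := by
    rw [hρ, div_lt_iff₀ hμ]; linarith
  have hb : 0 < βt := by
    rw [hβt, sub_pos, div_lt_iff₀ (by positivity)]; linarith
  have hab : βt < ρ / ((p : ℝ) * ((p : ℝ) + 1)) := by
    have hβρ : β < ρ / p := by rw [lt_div_iff₀ hp0]; linarith
    have hsplit : ρ / ((p : ℝ) * ((p : ℝ) + 1)) = ρ / p - ρ / ((p : ℝ) + 1) := by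
      field_simp; ring
    linarith
  have hcont := continuous_one_sub_div_rpow_mul_exp (hb.trans hab).le βt
  have hanti := strictAntiOn_one_sub_div_rpow_mul_exp hb hab
  set G : ℝ → ℝ := fun y : ℝ =>
    (1 - y / βt) ^ (ρ / ((p : ℝ) * ((p : ℝ) + 1))) * Real.exp y with hGdef
  have hG0 : G 0 = 1 := by simp [hGdef]
  have hGb : G βt = 0 := by
    simp only [hGdef]
    rw [div_self hb.ne', sub_self, Real.zero_rpow (hb.trans hab).ne', zero_mul]
  have hbij := bijOn_Ico_Ioc_of_strictAntiOn hb hcont.continuousOn hanti hG0 hGb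
  have hantiIco := hanti.mono Set.Ico_subset_Icc_self
  have hk : 0 < lam * ((Nat.factorial (p - 1) : ℝ) / ρ ^ (p - 1)) := by positivity
  simp only [neg_mul]
  refine ⟨⟨hcont.continuousOn, hantiIco, hbij⟩, fun t ht => ?_, fun Φ0 hΦ =>
    solution_of_eq_exp_neg hb hk hantiIco hbij hG0 hΦ⟩
  obtain ⟨y, hy, hyt⟩ := hbij.surjOn (show Real.exp (-(lam *
      ((Nat.factorial (p - 1) : ℝ) / ρ ^ (p - 1)) * t)) ∈ Set.Ioc 0 1 from
    ⟨Real.exp_pos _, Real.exp_le_one_iff.2 (neg_nonpos.2 (mul_nonneg hk.le ht))⟩)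
  exact ⟨y, ⟨hy, hyt⟩, fun z hz => hbij.injOn hz.1 hy (hz.2.trans hyt.symm)⟩
end
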